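/- Assume the flag setup with m_r = 1 and y_{r−1} > 0 (so all weights y_1, …, y_{r−1} are positive). Then a flag F of type (y, m) is semistable if and only if F_{r−1} (a hyperplane in k̄ ⊗_k V) does not contain k̄ ⊗_k L for any k-rational line L ⊆ V, i.e., for any k-subspace L of V with dim_k L = 1. -/

import Mathlib

/-- The `k`-linear inclusion of `k`-rational vectors into `Fin n → K`. -/
noncomputable def ratInclusion (k K : Type*) [Field k] [Field K] [Algebra k K] (n : ℕ) :
    (Fin n → k) →ₗ[k] (Fin n → K) where
  toFun v := fun i => algebraMap k K (v i)
  map_add' v w := by ext i; simp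
  map_smul' c v := by ext i; simp [Algebra.smul_def]

/-- Base change of a `k`-subspace `U ⊆ k^n` to a `K`-subspace of `K^n`. -/
noncomputable def baseChange (k K : Type*) [Field k] [Field K] [Algebra k K] (n : ℕ)
    (U : Submodule k (Fin n → k)) : Submodule K (Fin n → K) :=
  Submodule.span K (ratInclusion k K n '' (U : Set (Fin n → k)))

/-- The predecessor `F_{i-1}` of the flag step `F_i`, with `F_0 = 0` (0-based indexing). -/
noncomputable def flagPrev {K : Type*} [Field K] {n r : ℕ}
    (F : Fin r → Submodule K (Fin n → K)) (i : Fin r) : Submodule K (Fin n → K) :=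
  if _h : (i : ℕ) = 0 then ⊥
  else F ⟨(i : ℕ) - 1, lt_of_le_of_lt (Nat.sub_le _ _) i.isLt⟩

/-- The degree `deg_F(U) = ∑ᵢ yᵢ (dim(Fᵢ ∩ k̄⊗U) - dim(Fᵢ₋₁ ∩ k̄⊗U))` of a `k`-rational
subspace `U` with respect to the flag `F` with weights `y`. -/
noncomputable def degFlag (k K : Type*) [Field k] [Field K] [Algebra k K] (n r : ℕ)
    (y : Fin r → ℚ) (F : Fin r → Submodule K (Fin n → K))
    (U : Submodule k (Fin n → k)) : ℚ :=
  ∑ i : Fin r, y i *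
    ((Module.finrank K ↥(F i ⊓ baseChange k K n U) : ℚ) -
      (Module.finrank K ↥(flagPrev F i ⊓ baseChange k K n U) : ℚ))

/-- A flag is semistable if `deg_F(U) ≤ 0` for every nonzero `k`-rational subspace. -/
def IsSemistableFlag (k K : Type*) [Field k] [Field K] [Algebra k K] (n r : ℕ)
    (y : Fin r → ℚ) (F : Fin r → Submodule K (Fin n → K)) : Prop :=
  ∀ U : Submodule k (Fin n → k), U ≠ ⊥ → degFlag k K n r y F U ≤ 0

theorem baseChange_mono (k K : Type*) [Field k] [Field K] [Algebra k K] (n : ℕ)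
    {U W : Submodule k (Fin n → k)} (h : U ≤ W) : baseChange k K n U ≤ baseChange k K n W :=
  Submodule.span_mono (Set.image_mono h)

theorem ratInclusion_injective (k K : Type*) [Field k] [Field K] [Algebra k K] (n : ℕ) :
    Function.Injective (ratInclusion k K n) := fun _ _ h =>
  funext fun i => (algebraMap k K).injective (congrFun h i)

theorem baseChange_ne_bot (k K : Type*) [Field k] [Field K] [Algebra k K] (n : ℕ)
    {U : Submodule k (Fin n → k)} (h : U ≠ ⊥) : baseChange k K n U ≠ ⊥ := by
  obtain ⟨u, hu, hu0⟩ := Submodule.exists_mem_ne_zero_of_ne_bot h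
  intro hB
  have hmem : ratInclusion k K n u ∈ baseChange k K n U :=
    Submodule.subset_span (Set.mem_image_of_mem _ hu)
  rw [hB, Submodule.mem_bot] at hmem
  exact hu0 (ratInclusion_injective k K n (hmem.trans (map_zero _).symm))

/-- Intersecting with a subspace does not increase the codimension of `A` in `C`. -/
theorem finrank_inf_add_finrank_le {K V : Type*} [Field K] [AddCommGroup V] [Module K V]
    [FiniteDimensional K V] {A C : Submodule K V} (h : A ≤ C) (B : Submodule K V) :
    Module.finrank K ↥(C ⊓ B) + Module.finrank K A ≤
      Module.finrank K C + Module.finrank K ↥(A ⊓ B) := by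
  have hsum := Submodule.finrank_sup_add_finrank_inf_eq (C ⊓ B) A
  have hinf : C ⊓ B ⊓ A = A ⊓ B := by
    rw [inf_right_comm, inf_eq_right.2 h]
  have hsup : Module.finrank K ↥(C ⊓ B ⊔ A) ≤ Module.finrank K C :=
    Submodule.finrank_mono (sup_le inf_le_left h)
  rw [hinf] at hsum
  omega

theorem flagPrev_le {K : Type*} [Field K] {n r : ℕ} {F : Fin r → Submodule K (Fin n → K)}
    (hF : Monotone F) (i : Fin r) : flagPrev F i ≤ F i := by
  unfold flagPrev
  split_ifs with h
  · exact bot_le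
  · exact hF (Fin.mk_le_of_le_val (Nat.sub_le _ _))

theorem flagPrev_last {K : Type*} [Field K] {n r : ℕ} (F : Fin r → Submodule K (Fin n → K))
    (hr : 2 ≤ r) : flagPrev F ⟨r - 1, by omega⟩ = F ⟨r - 2, by omega⟩ := by
  unfold flagPrev
  rw [dif_neg (by simp only; omega)]
  rfl

theorem finrank_flagPrev_add {K : Type*} [Field K] {n r : ℕ} {m : Fin r → ℕ}
    {F : Fin r → Submodule K (Fin n → K)}
    (hdim : ∀ i : Fin r,
      Module.finrank K ↥(F i) = ∑ j ∈ Finset.univ.filter (· ≤ i), m j) (i : Fin r) :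
    Module.finrank K ↥(flagPrev F i) + m i = Module.finrank K ↥(F i) := by
  have hlt : Module.finrank K ↥(flagPrev F i) = ∑ j ∈ Finset.univ.filter (· < i), m j := by
    by_cases h : (i : ℕ) = 0
    · rw [flagPrev, dif_pos h, finrank_bot, Finset.filter_eq_empty_iff.2, Finset.sum_empty]
      intro j _ hj
      have := Fin.lt_def.1 hj
      omega
    · rw [flagPrev, dif_neg h, hdim]
      congr 1
      ext j
      simp only [Finset.mem_filter, Finset.mem_univ, true_and, Fin.le_def, Fin.lt_def]
      omega
  have hins : Finset.univ.filter (· ≤ i) = insert i (Finset.univ.filter (· < i)) := by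
    ext j
    simp [le_iff_eq_or_lt]
  rw [hlt, hdim, hins, Finset.sum_insert (by simp), add_comm]

/-- The graded pieces of a subspace with respect to a flag add up to its dimension. -/
theorem sum_finrank_flag_inf {K : Type*} [Field K] {n r : ℕ} (hr : 0 < r)
    {F : Fin r → Submodule K (Fin n → K)} (htop : F ⟨r - 1, by omega⟩ = ⊤)
    (B : Submodule K (Fin n → K)) :
    ∑ i : Fin r, ((Module.finrank K ↥(F i ⊓ B) : ℚ) - Module.finrank K ↥(flagPrev F i ⊓ B)) =
      Module.finrank K B := by
  let d : ℕ → ℚ := fun j =>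
    if h : j ≠ 0 ∧ j - 1 < r then (Module.finrank K ↥(F ⟨j - 1, h.2⟩ ⊓ B) : ℚ) else 0
  have hd : ∀ i : Fin r, (Module.finrank K ↥(F i ⊓ B) : ℚ) -
      Module.finrank K ↥(flagPrev F i ⊓ B) = d (i + 1) - d i := by
    intro i
    congr 1
    · simp [d]
    · by_cases h : (i : ℕ) = 0
      · rw [flagPrev, dif_pos h, bot_inf_eq]
        simp [d, h]
      · have hi : (i : ℕ) - 1 < r := by omega
        rw [flagPrev, dif_neg h]
        simp [d, h, hi]
  rw [Finset.sum_congr rfl fun i _ => hd i, Fin.sum_univ_eq_sum_range fun j => d (j + 1) - d j,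
    Finset.sum_range_sub]
  have hr' : r ≠ 0 ∧ r - 1 < r := by omega
  simp only [d]
  rw [dif_pos hr', dif_neg (by simp), htop, top_inf_eq, sub_zero]

/-- In the flag setup with `m_r = 1` and `y_{r-1} > 0`, a flag of type
`(y, m)` is semistable iff its hyperplane `F_{r-1}` does not contain `k̄ ⊗ L` for any
`k`-rational line `L ⊆ V = k^n`. -/
theorem stmt11 (k K : Type*) [Field k] [Finite k] [Field K] [Algebra k K]
    [IsAlgClosure k K]
    (n r : ℕ) (hn : 2 ≤ n) (hr : 2 ≤ r)
    (y : Fin r → ℚ) (hy : ∀ i j : Fin r, i < j → y j < y i)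
    (m : Fin r → ℕ) (hm : ∀ i, 1 ≤ m i) (hmsum : ∑ i, m i = n)
    (hwsum : ∑ i, (m i : ℚ) * y i = 0)
    (hmr : m ⟨r - 1, by omega⟩ = 1) (hyr : 0 < y ⟨r - 2, by omega⟩)
    (F : Fin r → Submodule K (Fin n → K)) (hmono : StrictMono F)
    (hdim : ∀ i : Fin r,
      Module.finrank K ↥(F i) = ∑ j ∈ Finset.univ.filter (· ≤ i), m j)
    (htop : F ⟨r - 1, by omega⟩ = ⊤) :
    IsSemistableFlag k K n r y F ↔
      ∀ L : Submodule k (Fin n → k), Module.finrank k ↥L = 1 →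
        ¬ (baseChange k K n L ≤ F ⟨r - 2, by omega⟩) := by
  have hlast : ∀ i : Fin r, i ≠ ⟨r - 1, by omega⟩ → i ≤ ⟨r - 2, by omega⟩ := by
    intro i hi
    rw [Ne, Fin.ext_iff] at hi
    rw [Fin.le_def]
    simp only at hi ⊢
    omega
  have hy_ge : ∀ i : Fin r, i ≠ ⟨r - 1, by omega⟩ → y ⟨r - 2, by omega⟩ ≤ y i := fun i hi =>
    (hlast i hi).eq_or_lt.elim (fun h => h ▸ le_rfl) fun h => (hy _ _ h).le
  constructor
  · intro hss L hL hle
    have hL0 : L ≠ ⊥ := by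
      rintro rfl
      simp at hL
    refine (hss L hL0).not_gt ?_
    have hB : 0 < (Module.finrank K ↥(baseChange k K n L) : ℚ) := by
      exact_mod_cast Nat.pos_of_ne_zero
        (mt Submodule.finrank_eq_zero.1 (baseChange_ne_bot k K n hL0))
    refine (mul_pos hyr hB).trans_le ?_
    rw [← sum_finrank_flag_inf (by omega) htop, Finset.mul_sum]
    refine Finset.sum_le_sum fun i _ => ?_
    by_cases hi : i = ⟨r - 1, by omega⟩
    · subst hi
      rw [flagPrev_last F hr, htop, top_inf_eq, inf_eq_right.2 hle]
      simp
    · refine mul_le_mul_of_nonneg_right (hy_ge i hi) (sub_nonneg.2 ?_)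
      exact_mod_cast Submodule.finrank_mono
        (inf_le_inf_right _ (flagPrev_le hmono.monotone i))
  · intro hline U hU
    have hylast : y ⟨r - 1, by omega⟩ ≤ 0 := by
      by_contra! hpos
      refine hwsum.not_gt (Finset.sum_pos (fun i _ => mul_pos ?_ ?_) ⟨⟨0, by omega⟩, by simp⟩)
      · exact_mod_cast hm i
      · by_cases hi : i = ⟨r - 1, by omega⟩
        · exact hi ▸ hpos
        · exact hyr.trans_le (hy_ge i hi)
    have hnot : ¬ baseChange k K n U ≤ F ⟨r - 2, by omega⟩ := by
      obtain ⟨u, hu, hu0⟩ := Submodule.exists_mem_ne_zero_of_ne_bot hU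
      exact fun h => hline (k ∙ u) (finrank_span_singleton hu0)
        ((baseChange_mono k K n ((Submodule.span_singleton_le_iff_mem _ _).2 hu)).trans h)
    rw [← hwsum]
    refine Finset.sum_le_sum fun i _ => ?_
    rw [mul_comm (m i : ℚ)]
    by_cases hi : i = ⟨r - 1, by omega⟩
    · subst hi
      rw [flagPrev_last F hr, htop, top_inf_eq, hmr]
      refine mul_le_mul_of_nonpos_left ?_ hylast
      have hlt := Submodule.finrank_lt_finrank_of_lt (inf_lt_right.2 hnot)
      rw [Nat.cast_one, le_sub_iff_add_le']
      exact_mod_cast hlt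
    · refine mul_le_mul_of_nonneg_left ?_ (hyr.trans_le (hy_ge i hi)).le
      have hcodim := finrank_inf_add_finrank_le (flagPrev_le hmono.monotone i)
        (baseChange k K n U)
      have hdim_i := finrank_flagPrev_add hdim i
      rw [sub_le_iff_le_add]
      norm_cast
      omega
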